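/- Let X be an infinite compact Hausdorff space admitting a T₀-separating family 𝒰 of open Fσ subsets which is weakly σ-point-finite (Sokolov's characterization of Gul'ko compactness). Then there exist a zero-dimensional compact Hausdorff space Y with the same weight as X, a T₀-separating weakly σ-point-finite family of clopen subsets of Y, and a continuous surjection from Y onto X. -/

import Mathlib

universe u

/-- The weight of a topological space: the least cardinality of an open base. -/
noncomputable def tweight (X : Type*) [TopologicalSpace X] : Cardinal :=
  ⨅ B : {B : Set (Set X) // TopologicalSpace.IsTopologicalBasis B}, Cardinal.mk B.1

/-- A family of subsets is `T₀`-separating if any two distinct points are separated: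
some member contains exactly one of them. -/
def T0Separating {X : Type*} (U : Set (Set X)) : Prop :=
  ∀ x y : X, x ≠ y → ∃ u ∈ U, Xor' (x ∈ u) (y ∈ u)

/-- A family `U` is weakly σ-point-finite if `U = ⋃ n, Uₙ` in such a way that for
every point `x`, every `v ∈ U` lies in some `Uₙ` with `{w ∈ Uₙ : x ∈ w}` finite. -/
def WeaklySigmaPointFinite {X : Type*} (U : Set (Set X)) : Prop :=
  ∃ u : ℕ → Set (Set X), U = ⋃ n, u n ∧
    ∀ x : X, ∀ v ∈ U, ∃ n, v ∈ u n ∧ {w | w ∈ u n ∧ x ∈ w}.Finite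

/-- An open `Fσ` set: an open set which is a countable union of closed sets. -/
def IsOpenFSigma {X : Type*} [TopologicalSpace X] (s : Set X) : Prop :=
  IsOpen s ∧ ∃ c : ℕ → Set X, (∀ n, IsClosed (c n)) ∧ s = ⋃ n, c n

open Cardinal TopologicalSpace in
/-- The weight is bounded by the cardinality of any open base. -/
theorem tweight_le_mk {Z : Type u} [TopologicalSpace Z] {B : Set (Set Z)}
    (hB : IsTopologicalBasis B) : tweight Z ≤ #B :=
  ciInf_le' (fun B : {B : Set (Set Z) // IsTopologicalBasis B} => #B.1) ⟨B, hB⟩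

open Cardinal TopologicalSpace in
/-- The weight is attained by some open base. -/
theorem exists_isTopologicalBasis_mk_eq_tweight (Z : Type u) [TopologicalSpace Z] :
    ∃ B : Set (Set Z), IsTopologicalBasis B ∧ #B = tweight Z := by
  have : Nonempty {B : Set (Set Z) // IsTopologicalBasis B} := ⟨⟨_, isTopologicalBasis_opens⟩⟩
  obtain ⟨B, hB⟩ := ciInf_mem (fun B : {B : Set (Set Z) // IsTopologicalBasis B} => #B.1)
  exact ⟨B.1, B.2, hB⟩

open Cardinal TopologicalSpace in
theorem aleph0_le_tweight (Z : Type u) [TopologicalSpace Z] [T0Space Z] [Infinite Z] :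
    ℵ₀ ≤ tweight Z := by
  obtain ⟨B, hB, hcard⟩ := exists_isTopologicalBasis_mk_eq_tweight Z
  rw [← hcard]
  by_contra! hlt
  have : Finite B := lt_aleph0_iff_finite.1 hlt
  have hinj : Function.Injective fun (x : Z) => {b : B | x ∈ b.1} := by
    intro x y hxy
    refine hB.inseparable_iff.2 (fun b hb => ?_) |>.eq
    simpa using Set.ext_iff.1 hxy ⟨b, hb⟩
  exact not_finite_iff_infinite.2 ‹Infinite Z› (Finite.of_injective _ hinj)

open Cardinal in
theorem mk_finset_le_max (α : Type u) : #(Finset α) ≤ max #α ℵ₀ := by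
  cases finite_or_infinite α
  · exact (lt_aleph0_of_finite _).le.trans (le_max_right _ _)
  · simp

open Cardinal TopologicalSpace in
/-- The weight of a space is bounded by the cardinality of any infinite open subbase. -/
theorem tweight_le_of_generateFrom {Z : Type u} [t : TopologicalSpace Z] {S : Set (Set Z)}
    (hS : t = generateFrom S) : tweight Z ≤ max #S ℵ₀ := by
  refine (tweight_le_mk (isTopologicalBasis_of_subbasis hS)).trans
    (le_trans ?_ (mk_finset_le_max S))
  refine (mk_le_mk_of_subset ?_).trans
    (mk_range_le (f := fun F : Finset S => ⋂₀ (Subtype.val '' (F : Set S))))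
  rintro _ ⟨f, ⟨hf, hfS⟩, rfl⟩
  lift f to Set S using hfS
  have hf' : f.Finite := hf.of_finite_image Subtype.val_injective.injOn
  exact ⟨hf'.toFinset, by simp⟩

open Cardinal TopologicalSpace in
/-- A space embedded in a power `E ^ ι` of a second countable space has weight at most
`max #ι ℵ₀`. -/
theorem tweight_le_of_isInducing {Z ι : Type u} {E : Type*} [TopologicalSpace Z]
    [TopologicalSpace E] [SecondCountableTopology E] {g : Z → ι → E}
    (hg : Topology.IsInducing g) : tweight Z ≤ max #ι ℵ₀ := by
  obtain ⟨b, hb⟩ := exists_seq_basis E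
  have hS := hg.eq_induced
  rw [induced_to_pi] at hS
  simp_rw [hb.eq_generateFrom, induced_generateFrom_eq] at hS
  rw [← generateFrom_iUnion] at hS
  refine (tweight_le_of_generateFrom hS).trans (max_le ?_ (le_max_right _ _))
  calc #(⋃ i, Set.preimage (fun x => g x i) '' Set.range b)
      ≤ #(Set.range fun p : ι × ULift.{u} ℕ => (fun x => g x p.1) ⁻¹' b p.2.down) := by
        refine mk_le_mk_of_subset ?_
        rintro s hs
        simp only [Set.mem_iUnion, Set.mem_image, Set.mem_range] at hs
        obtain ⟨i, _, ⟨n, rfl⟩, rfl⟩ := hs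
        exact ⟨(i, ⟨n⟩), rfl⟩
    _ ≤ #(ι × ULift.{u} ℕ) := mk_range_le
    _ = #ι * ℵ₀ := by simp
    _ ≤ max #ι ℵ₀ := (mul_le_max _ _).trans (by simp)

open Cardinal TopologicalSpace in
/-- A weakly σ-point-finite family of open sets in an infinite space has at most as many
members as the weight. -/
theorem WeaklySigmaPointFinite.mk_le_tweight {Z : Type u} [TopologicalSpace Z] [T0Space Z]
    [Infinite Z] {U : Set (Set Z)} (hU : WeaklySigmaPointFinite U)
    (hopen : ∀ u ∈ U, IsOpen u) : #U ≤ tweight Z := by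
  have hw := aleph0_le_tweight Z
  obtain ⟨B, hB, hcard⟩ := exists_isTopologicalBasis_mk_eq_tweight Z
  obtain ⟨p⟩ : Nonempty Z := inferInstance
  obtain ⟨u, hu, hfin⟩ := hU
  classical
  let pt : Set Z → Z := fun b => if h : b.Nonempty then h.some else p
  have hpt : ∀ b : Set Z, b.Nonempty → pt b ∈ b := fun b h => by
    simp only [pt, dif_pos h]; exact h.some_mem
  let F : B × ULift.{u} ℕ → Set (Set Z) := fun q =>
    {w | w ∈ u q.2.down ∧ pt q.1.1 ∈ w ∧ {w | w ∈ u q.2.down ∧ pt q.1.1 ∈ w}.Finite}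
  have hF : ∀ q, #(F q) ≤ ℵ₀ := fun q => by
    by_cases h : {w | w ∈ u q.2.down ∧ pt q.1.1 ∈ w}.Finite
    · exact (h.subset fun w hw => ⟨hw.1, hw.2.1⟩).lt_aleph0.le
    · have : F q = ∅ := Set.eq_empty_of_forall_notMem fun w hw => h hw.2.2
      simp [this]
  have hsub : U ⊆ insert ∅ (⋃ q, F q) := by
    intro w hw
    rcases w.eq_empty_or_nonempty with rfl | ⟨x, hx⟩
    · exact Set.mem_insert _ _
    · obtain ⟨b, hb, hxb, hbw⟩ := hB.exists_subset_of_mem_open hx (hopen w hw)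
      obtain ⟨n, hn, hn'⟩ := hfin (pt b) w hw
      exact Or.inr (Set.mem_iUnion.2 ⟨(⟨b, hb⟩, ⟨n⟩), hn, hbw (hpt b ⟨x, hxb⟩), hn'⟩)
  calc #U ≤ #(⋃ q, F q) + 1 := (mk_le_mk_of_subset hsub).trans mk_insert_le
    _ ≤ #(B × ULift.{u} ℕ) * ℵ₀ + 1 := by
        gcongr
        exact (mk_iUnion_le _).trans (by gcongr; exact ciSup_le' hF)
    _ = tweight Z * ℵ₀ * ℵ₀ + 1 := by simp [hcard]
    _ = tweight Z := by
        rw [mul_aleph0_eq hw, mul_aleph0_eq hw, add_one_eq hw]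

/-- Weak σ-point-finiteness passes to preimages. -/
theorem WeaklySigmaPointFinite.preimage {X Y : Type*} {U : Set (Set X)}
    (hU : WeaklySigmaPointFinite U) (f : Y → X) :
    WeaklySigmaPointFinite (Set.preimage f '' U) := by
  obtain ⟨u, rfl, hfin⟩ := hU
  refine ⟨fun n => Set.preimage f '' u n, by rw [Set.image_iUnion], ?_⟩
  rintro y _ ⟨v, hv, rfl⟩
  obtain ⟨n, hn, hn'⟩ := hfin (f y) v hv
  refine ⟨n, ⟨v, hn, rfl⟩, (hn'.image (Set.preimage f)).subset ?_⟩
  rintro _ ⟨⟨w, hw, rfl⟩, hy⟩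
  exact ⟨w, ⟨hw, hy⟩, rfl⟩

/-- Shrinking each preimage of a member of a weakly σ-point-finite family in countably many
ways yields a weakly σ-point-finite family. -/
theorem WeaklySigmaPointFinite.range_shrink {X Y : Type*} {U : Set (Set X)}
    (hU : WeaklySigmaPointFinite U) (f : Y → X) (W : U → ℕ → Set Y)
    (hW : ∀ u n, W u n ⊆ f ⁻¹' u) :
    WeaklySigmaPointFinite (Set.range fun p : U × ℕ => W p.1 p.2) := by
  obtain ⟨u, hu, hfin⟩ := hU
  refine ⟨fun k => {w | ∃ v : U, v.1 ∈ u k.unpair.1 ∧ w = W v k.unpair.2}, ?_, ?_⟩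
  · ext w
    simp only [Set.mem_range, Set.mem_iUnion, Set.mem_ofPred_eq]
    constructor
    · rintro ⟨⟨v, n⟩, rfl⟩
      obtain ⟨m, hm⟩ := Set.mem_iUnion.1 (hu.subset v.2)
      exact ⟨Nat.pair m n, v, by simpa using hm, by simp⟩
    · rintro ⟨k, v, -, rfl⟩
      exact ⟨(v, k.unpair.2), rfl⟩
  · rintro y _ ⟨⟨v, n⟩, rfl⟩
    obtain ⟨m, hm, hm'⟩ := hfin (f y) v v.2
    refine ⟨Nat.pair m n, ⟨v, by simpa using hm, by simp⟩, ?_⟩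
    have hfin' : {v : U | v.1 ∈ u m ∧ f y ∈ v.1}.Finite :=
      hm'.preimage Subtype.val_injective.injOn
    refine (hfin'.image fun v => W v n).subset ?_
    rintro _ ⟨⟨v', hv', rfl⟩, hy⟩
    rw [Nat.unpair_pair] at hv' hy ⊢
    exact ⟨v', ⟨hv', hW _ _ hy⟩, rfl⟩

/-- An open `Fσ` set in a compact Hausdorff space is a cozero set. -/
theorem IsOpenFSigma.exists_continuousMap {X : Type*} [TopologicalSpace X] [CompactSpace X]
    [T2Space X] {s : Set X} (hs : IsOpenFSigma s) :
    ∃ f : C(X, ℝ), (∀ x, f x ∈ Set.Icc (0 : ℝ) 1) ∧ ∀ x, x ∈ s ↔ f x ≠ 0 := by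
  obtain ⟨ho, c, hc, rfl⟩ := hs
  have hG : IsGδ (⋃ n, c n)ᶜ := by
    rw [Set.compl_iUnion]
    exact .iInter_of_isOpen fun n => (hc n).isOpen_compl
  obtain ⟨g, hg, -, -, hg01⟩ := exists_continuous_one_zero_of_isCompact_of_isGδ
    ho.isClosed_compl.isCompact hG isClosed_empty (Set.disjoint_empty _)
  refine ⟨1 - g, fun x => ?_, fun x => ?_⟩
  · have := hg01 x
    simp only [ContinuousMap.sub_apply, ContinuousMap.one_apply, Set.mem_Icc] at *
    constructor <;> linarith
  · rw [← not_iff_not, ← Set.mem_compl_iff, hg]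
    simp [sub_eq_zero, eq_comm (a := g x)]

theorem Real.ofDigits_ne_zero {b : ℕ} {d : ℕ → Fin b} {n : ℕ} (hn : (d n : ℕ) ≠ 0) :
    Real.ofDigits d ≠ 0 := by
  have hb : 0 < b := Fin.pos (d n)
  have hpos : 0 < Real.ofDigitsTerm d n := by
    unfold Real.ofDigitsTerm
    positivity
  exact (hpos.trans_le (Real.summable_ofDigitsTerm.le_tsum n
    fun _ _ => Real.ofDigitsTerm_nonneg)).ne'

/-- Every (infinite) Gul'ko compact space—i.e. a compact Hausdorff space with a
`T₀`-separating weakly σ-point-finite family of open `Fσ` sets (Sokolov's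
characterization)—is a continuous image of a zero-dimensional Gul'ko compact space of
the same weight, where zero-dimensional Gul'ko compactness is witnessed by a
`T₀`-separating weakly σ-point-finite family of clopen sets. -/
theorem gulko_zero_dimensional_preimage (X : Type u) [TopologicalSpace X]
    [CompactSpace X] [T2Space X] [Infinite X]
    (U : Set (Set X)) (hUopen : ∀ u ∈ U, IsOpenFSigma u)
    (hUsep : T0Separating U) (hUpf : WeaklySigmaPointFinite U) :
    ∃ (Y : Type u) (tY : TopologicalSpace Y),
      @CompactSpace Y tY ∧ @T2Space Y tY ∧
      @TopologicalSpace.IsTopologicalBasis Y tY {s : Set Y | @IsClopen Y tY s} ∧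
      @tweight Y tY = tweight X ∧
      (∃ W : Set (Set Y), (∀ w ∈ W, @IsClopen Y tY w) ∧
        T0Separating W ∧ WeaklySigmaPointFinite W) ∧
      ∃ f : Y → X, @Continuous Y X tY _ f ∧ Function.Surjective f := by
  choose g hg01 hg using fun u : U => (hUopen u u.2).exists_continuousMap
  let e : X → U → ℝ := fun x u => g u x
  have he : Continuous e := continuous_pi fun u => (g u).continuous
  have heinj : Function.Injective e := by
    intro x y hxy
    by_contra hne
    obtain ⟨u, hu, hx⟩ := hUsep x y hne
    have : x ∈ u ↔ y ∈ u := by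
      rw [hg ⟨u, hu⟩ x, hg ⟨u, hu⟩ y, show g ⟨u, hu⟩ x = g ⟨u, hu⟩ y from congrFun hxy _]
    rw [this] at hx
    exact (xor_self _).mp hx
  have hemb : Topology.IsClosedEmbedding e := he.isClosedEmbedding heinj
  let φ : (U → ℕ → Fin 2) → U → ℝ := fun y u => Real.ofDigits (y u)
  have hφ : Continuous φ :=
    continuous_pi fun u => Real.continuous_ofDigits.comp (continuous_apply u)
  let Y : Type u := φ ⁻¹' Set.range e
  have : CompactSpace Y :=
    isCompact_iff_compactSpace.1 (hemb.isClosed_range.preimage hφ).isCompact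
  choose f hf using fun y : Y => y.2
  have hfc : Continuous f := by
    rw [hemb.isInducing.continuous_iff]
    exact (hφ.comp continuous_subtype_val).congr fun y => (hf y).symm
  have hfs : Function.Surjective f := by
    intro x
    choose d hd using fun u => Real.ofDigits_SurjOn one_lt_two (hg01 u x)
    have hd' : φ d = e x := funext fun u => (hd u).2
    exact ⟨⟨d, x, hd'.symm⟩, heinj ((hf _).trans hd')⟩
  have : Infinite Y := .of_surjective f hfs
  refine ⟨Y, inferInstance, inferInstance, inferInstance, isTopologicalBasis_isClopen,
    le_antisymm ?_ ?_, ⟨Set.range fun p : U × ℕ => {y : Y | y.1 p.1 p.2 = 1}, ?_, ?_, ?_⟩,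
    f, hfc, hfs⟩
  · have hval : Topology.IsInducing fun y : Y => y.1 := .subtypeVal
    refine (tweight_le_of_isInducing hval).trans (max_le ?_ (aleph0_le_tweight X))
    exact hUpf.mk_le_tweight fun u hu => (hUopen u hu).1
  · refine (tweight_le_of_isInducing hemb.isInducing).trans (max_le ?_ (aleph0_le_tweight Y))
    rw [← Cardinal.mk_image_eq hfs.preimage_injective]
    refine (hUpf.preimage f).mk_le_tweight ?_
    rintro _ ⟨u, hu, rfl⟩
    exact (hUopen u hu).1.preimage hfc
  · rintro _ ⟨⟨u, n⟩, rfl⟩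
    have hc : Continuous fun y : Y => y.1 u n :=
      (continuous_apply_apply u n).comp continuous_subtype_val
    exact (isClopen_discrete {1}).preimage hc
  · intro x y hxy
    obtain ⟨u, hu⟩ := Function.ne_iff.1 (Subtype.coe_ne_coe.2 hxy)
    obtain ⟨n, hn⟩ := Function.ne_iff.1 hu
    refine ⟨_, ⟨(u, n), rfl⟩, ?_⟩
    change Xor (x.1 u n = 1) (y.1 u n = 1)
    generalize x.1 u n = a at hn
    generalize y.1 u n = b at hn
    revert a b
    decide
  · refine hUpf.range_shrink f (fun u n => {y : Y | y.1 u n = 1}) fun u n y hy => ?_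
    rw [Set.mem_preimage, hg u, show g u (f y) = Real.ofDigits (y.1 u) from congrFun (hf y) u]
    exact Real.ofDigits_ne_zero (n := n) (by simp [show y.1 u n = 1 from hy])
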